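/- arXiv:1204.3535 — 5 statements merged into one kernel-verified Lean document; each statement's English description precedes it below -/
import Mathlib

section
/- Let p be a prime and let M be a finitely generated module over the ring ℤ_p of p-adic integers, equipped with a ℤ_p-linear automorphism γ. Then the coinvariants M_γ = M/(1−γ)M form a finite set if and only if the invariants M^γ = ker(1−γ) form a finite set. -/
theorem PadicInt.hasFiniteQuotients (p : ℕ) [Fact p.Prime] : Ring.HasFiniteQuotients ℤ_[p] where
  finiteQuotient {I} hI := by
    have : Finite (IsLocalRing.ResidueField ℤ_[p]) :=
      Finite.of_equiv _ (PadicInt.residueField (p := p)).symm.toEquiv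
    obtain ⟨n, rfl⟩ := PadicInt.ideal_eq_span_pow_p hI
    refine IsLocalRing.finite_quotient_iff.mpr ⟨n, ?_⟩
    rw [PadicInt.maximalIdeal_eq_span_p, Ideal.span_singleton_pow]

/-- A finite module over an infinite domain is torsion. -/
theorem Module.IsTorsion.of_finite {R N : Type*} [CommRing R] [IsDomain R] [Infinite R]
    [AddCommGroup N] [Module R N] [Finite N] : Module.IsTorsion R N := by
  intro x
  obtain ⟨a, b, hab, hne⟩ := Function.not_injective_iff.mp
    (not_injective_infinite_finite fun r : R => r • x)
  refine ⟨⟨a - b, mem_nonZeroDivisors_of_ne_zero (sub_ne_zero.mpr hne)⟩, ?_⟩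
  change (a - b) • x = 0
  rw [sub_smul, sub_eq_zero]
  exact hab

theorem Module.IsTorsion.finite_of_hasFiniteQuotients {R N : Type*} [CommRing R] [IsDomain R]
    [Ring.HasFiniteQuotients R] [AddCommGroup N] [Module R N] [Module.Finite R N]
    (h : Module.IsTorsion R N) : Finite N := by
  obtain ⟨a, ha, ha'⟩ := Submodule.annihilator_top_inter_nonZeroDivisors h
  set I := (⊤ : Submodule R N).annihilator with hI
  have hne : I ≠ ⊥ := by
    intro hbot
    rw [hbot] at ha
    exact nonZeroDivisors.ne_zero ha' (by simpa using ha)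
  have : Finite (R ⧸ I) := Ring.HasFiniteQuotients.finiteQuotient hne
  have hfin : Finite (N ⧸ I • (⊤ : Submodule R N)) :=
    Submodule.finite_quotient_smul I Module.Finite.fg_top
  rw [hI, Submodule.annihilator_smul] at hfin
  exact Finite.of_equiv _ (Submodule.quotEquivOfEqBot (⊥ : Submodule R N) rfl).toEquiv

theorem Module.finite_iff_finrank_eq_zero {R N : Type*} [CommRing R] [IsDomain R] [Infinite R]
    [Ring.HasFiniteQuotients R] [AddCommGroup N] [Module R N] [Module.Finite R N] :
    Finite N ↔ Module.finrank R N = 0 := by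
  rw [Module.finrank_eq_zero_iff_isTorsion]
  exact ⟨fun _ => .of_finite, fun h => h.finite_of_hasFiniteQuotients⟩

theorem LinearMap.finrank_quotient_range_eq_finrank_ker {R N : Type*} [CommRing R] [IsDomain R]
    [AddCommGroup N] [Module R N] [Module.Finite R N] (f : N →ₗ[R] N) :
    Module.finrank R (N ⧸ LinearMap.range f) = Module.finrank R (LinearMap.ker f) := by
  have h₁ := (LinearMap.range f).finrank_quotient_add_finrank
  have h₂ := f.quotKerEquivRange.finrank_eq
  have h₃ := (LinearMap.ker f).finrank_quotient_add_finrank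
  lia

/-- For a finitely generated `ℤ_p`-module `M` with a `ℤ_p`-linear automorphism `γ`,
the coinvariants `M/(1-γ)M` are finite iff the invariants `ker(1-γ)` are finite. -/
theorem finite_coinvariants_iff_finite_invariants
    (p : ℕ) [Fact p.Prime]
    {M : Type*} [AddCommGroup M] [Module ℤ_[p] M] [Module.Finite ℤ_[p] M]
    (γ : M ≃ₗ[ℤ_[p]] M) :
    Finite (M ⧸ LinearMap.range ((1 : M →ₗ[ℤ_[p]] M) - γ.toLinearMap)) ↔
      Finite (LinearMap.ker ((1 : M →ₗ[ℤ_[p]] M) - γ.toLinearMap)) := by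
  have := PadicInt.hasFiniteQuotients p
  rw [Module.finite_iff_finrank_eq_zero (R := ℤ_[p]), Module.finite_iff_finrank_eq_zero (R := ℤ_[p]),
    LinearMap.finrank_quotient_range_eq_finrank_ker]
end

section
/- Let p be a prime and let M be a finitely generated free ℤ_p-module with a ℤ_p-linear automorphism γ such that the coinvariants M_γ = M/(1−γ)M are finite. Let M* = Hom_{ℤ_p}(M, ℤ_p), equipped with the automorphism γ* given by γ*(φ) = φ ∘ γ^{−1}. Then there is an isomorphism of ℤ_p-modules Hom_{ℤ_p}(M/(1−γ)M, ℚ_p/ℤ_p) ≅ M*/(1−γ*)M*. -/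
section DualCokernel

variable {R K M : Type*} [CommRing R] [Field K] [Algebra R K] [AddCommGroup M] [Module R M]

/-- If `g ∘ f` is multiplication by `d`, a functional `φ` on `M` induces the map
`M / f(M) → K / R`, `m ↦ φ (g m) / d`. -/
noncomputable def dualToCokernelHom {f g : M →ₗ[R] M} {d : R} (hd : algebraMap R K d ≠ 0)
    (hgf : ∀ m, g (f m) = d • m) :
    Module.Dual R M →ₗ[R]
      ((M ⧸ LinearMap.range f) →ₗ[R] (K ⧸ LinearMap.range (Algebra.linearMap R K))) where
  toFun φ := (LinearMap.range f).liftQ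
    ((LinearMap.range (Algebra.linearMap R K)).mkQ ∘ₗ
      LinearMap.mulLeft R (algebraMap R K d)⁻¹ ∘ₗ Algebra.linearMap R K ∘ₗ φ ∘ₗ g) (by
    rintro _ ⟨m, rfl⟩
    simp only [LinearMap.mem_ker, LinearMap.comp_apply, Submodule.mkQ_apply,
      Submodule.Quotient.mk_eq_zero, hgf]
    exact ⟨φ m, by simp [inv_mul_cancel_left₀ hd]⟩)
  map_add' φ ψ := by
    ext m
    simp [mul_add]
  map_smul' r φ := by
    ext m
    simp [← Submodule.Quotient.mk_smul, Algebra.smul_def, mul_left_comm]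

lemma dualToCokernelHom_apply_mk {f g : M →ₗ[R] M} {d : R} (hd : algebraMap R K d ≠ 0)
    (hgf : ∀ m, g (f m) = d • m) (φ : Module.Dual R M) (m : M) :
    dualToCokernelHom hd hgf φ (Submodule.Quotient.mk m) =
      Submodule.Quotient.mk ((algebraMap R K d)⁻¹ * algebraMap R K (φ (g m))) :=
  rfl

lemma ker_dualToCokernelHom [FaithfulSMul R K] {f g : M →ₗ[R] M} {d : R}
    (hd : algebraMap R K d ≠ 0) (hgf : ∀ m, g (f m) = d • m) (hfg : ∀ m, f (g m) = d • m) :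
    LinearMap.ker (dualToCokernelHom hd hgf) = LinearMap.range f.dualMap := by
  have hinj := FaithfulSMul.algebraMap_injective R K
  ext φ
  rw [LinearMap.mem_ker]
  constructor
  · intro h
    have hχ (m : M) : ∃ r : R, φ (g m) = d * r := by
      have hm := DFunLike.congr_fun h (Submodule.Quotient.mk m)
      rw [dualToCokernelHom_apply_mk, LinearMap.zero_apply, Submodule.Quotient.mk_eq_zero] at hm
      obtain ⟨r, hr⟩ := hm
      refine ⟨r, hinj ?_⟩
      rw [map_mul, ← Algebra.linearMap_apply (R := R) (A := K) r, hr, mul_inv_cancel_left₀ hd]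
    choose χ hχ using hχ
    have hcancel {a b : R} (hab : d * a = d * b) : a = b := hinj (mul_left_cancel₀ hd (by
      rw [← map_mul, ← map_mul, hab]))
    refine ⟨{ toFun := χ, map_add' := fun x y ↦ hcancel ?_, map_smul' := fun r x ↦ hcancel ?_ }, ?_⟩
    · rw [← hχ, mul_add, ← hχ, ← hχ, map_add, map_add]
    · rw [← hχ, RingHom.id_apply, smul_eq_mul, mul_left_comm, ← hχ, map_smul, map_smul, smul_eq_mul]
    · ext m
      refine hcancel ?_
      rw [LinearMap.dualMap_apply, LinearMap.coe_mk, AddHom.coe_mk, ← hχ, hgf, map_smul,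
        smul_eq_mul]
  · rintro ⟨χ, rfl⟩
    ext m
    change dualToCokernelHom hd hgf (f.dualMap χ) (Submodule.Quotient.mk m) = 0
    rw [dualToCokernelHom_apply_mk, Submodule.Quotient.mk_eq_zero]
    exact ⟨χ m, by simp [hfg, inv_mul_cancel_left₀ hd]⟩

lemma dualToCokernelHom_surjective [FaithfulSMul R K] [Module.Projective R M] {f g : M →ₗ[R] M}
    {d : R} (hd : algebraMap R K d ≠ 0) (hgf : ∀ m, g (f m) = d • m)
    (hfg : ∀ m, f (g m) = d • m) :
    Function.Surjective (dualToCokernelHom hd hgf) := by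
  intro h
  obtain ⟨ψ, hψ⟩ := Module.projective_lifting_property
    (LinearMap.range (Algebra.linearMap R K)).mkQ (h ∘ₗ (LinearMap.range f).mkQ)
    (Submodule.mkQ_surjective _)
  have hψ' (m : M) : Submodule.Quotient.mk (ψ m) = h (Submodule.Quotient.mk m) :=
    DFunLike.congr_fun hψ m
  have hmem (m : M) : ψ (f m) ∈ LinearMap.range (Algebra.linearMap R K) := by
    rw [← Submodule.Quotient.mk_eq_zero, hψ',
      (Submodule.Quotient.mk_eq_zero _).2 (LinearMap.mem_range_self f m), map_zero]
  let e := LinearEquiv.ofInjective (Algebra.linearMap R K) (FaithfulSMul.algebraMap_injective R K)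
  have he (m : M) : algebraMap R K (e.symm ⟨ψ (f m), hmem m⟩) = ψ (f m) :=
    congrArg Subtype.val (e.apply_symm_apply ⟨ψ (f m), hmem m⟩)
  refine ⟨e.symm.toLinearMap ∘ₗ (ψ ∘ₗ f).codRestrict _ hmem, ?_⟩
  ext m
  change dualToCokernelHom hd hgf _ (Submodule.Quotient.mk m) = h (Submodule.Quotient.mk m)
  rw [dualToCokernelHom_apply_mk, ← hψ']
  congr 1
  change _ * algebraMap R K (e.symm ⟨ψ (f (g m)), hmem (g m)⟩) = _
  rw [he, hfg, map_smul, Algebra.smul_def, inv_mul_cancel_left₀ hd]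

end DualCokernel

/-- An endomorphism of a finite free module over a domain whose cokernel is killed by a nonzero
scalar has a two-sided inverse up to a nonzero scalar. -/
lemma exists_comp_eq_smul_of_smul_mem_range {R M : Type*} [CommRing R] [IsDomain R]
    [AddCommGroup M] [Module R M] [Module.Finite R M] [Module.Free R M] (f : M →ₗ[R] M) {c : R}
    (hc : c ≠ 0) (hf : ∀ m, c • m ∈ LinearMap.range f) :
    ∃ (g : M →ₗ[R] M) (d : R), d ≠ 0 ∧ (∀ m, g (f m) = d • m) ∧ ∀ m, f (g m) = d • m := by
  classical
  let b := Module.Free.chooseBasis R M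
  obtain ⟨g, hg⟩ := Module.projective_lifting_property f.rangeRestrict
    ((c • LinearMap.id : M →ₗ[R] M).codRestrict (LinearMap.range f) hf)
    f.surjective_rangeRestrict
  have hfg : f ∘ₗ g = c • LinearMap.id :=
    LinearMap.ext fun m ↦ congrArg Subtype.val (DFunLike.congr_fun hg m)
  have hdet : LinearMap.det f ≠ 0 := by
    refine left_ne_zero_of_mul (b := LinearMap.det g) ?_
    rw [← LinearMap.det_comp, hfg, LinearMap.det_smul, LinearMap.det_id, mul_one]
    exact pow_ne_zero _ hc
  rw [← LinearMap.det_toMatrix b] at hdet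
  have hf' : Matrix.toLin b b (LinearMap.toMatrix b b f) = f := Matrix.toLin_toMatrix b b f
  refine ⟨Matrix.toLin b b (LinearMap.toMatrix b b f).adjugate, _, hdet, fun m ↦ ?_, fun m ↦ ?_⟩
  · rw [← LinearMap.comp_apply]
    nth_rewrite 2 [← hf']
    rw [← Matrix.toLin_mul, Matrix.adjugate_mul, map_smul, Matrix.toLin_one]
    rfl
  · rw [← LinearMap.comp_apply]
    nth_rewrite 1 [← hf']
    rw [← Matrix.toLin_mul, Matrix.mul_adjugate, map_smul, Matrix.toLin_one]
    rfl

lemma range_one_sub_dualMap_symm {R M : Type*} [CommRing R] [AddCommGroup M] [Module R M]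
    (γ : M ≃ₗ[R] M) :
    LinearMap.range ((1 : Module.Dual R M →ₗ[R] Module.Dual R M) -
      LinearMap.dualMap γ.symm.toLinearMap) =
    LinearMap.range ((1 : M →ₗ[R] M) - γ.toLinearMap).dualMap := by
  apply le_antisymm
  · rintro _ ⟨φ, rfl⟩
    exact ⟨-(φ ∘ₗ γ.symm.toLinearMap), by ext m; simp⟩
  · rintro _ ⟨φ, rfl⟩
    exact ⟨-(φ ∘ₗ γ.toLinearMap), by ext m; simp; abel⟩


/-- For a finitely generated free `ℤ_p`-module `M` with automorphism `γ` whose coinvariants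
`M/(1-γ)M` are finite, there is a `ℤ_p`-module isomorphism
`Hom(M/(1-γ)M, ℚ_p/ℤ_p) ≅ M*/(1-γ*)M*`, where `M* = Hom(M, ℤ_p)` and `γ*(φ) = φ ∘ γ⁻¹`. -/
theorem dual_coinvariants_iso
    (p : ℕ) [Fact p.Prime]
    {M : Type*} [AddCommGroup M] [Module ℤ_[p] M]
    [Module.Finite ℤ_[p] M] [Module.Free ℤ_[p] M]
    (γ : M ≃ₗ[ℤ_[p]] M)
    (hfin : Finite (M ⧸ LinearMap.range ((1 : M →ₗ[ℤ_[p]] M) - γ.toLinearMap))) :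
    Nonempty
      (((M ⧸ LinearMap.range ((1 : M →ₗ[ℤ_[p]] M) - γ.toLinearMap)) →ₗ[ℤ_[p]]
          (ℚ_[p] ⧸ LinearMap.range (Algebra.linearMap ℤ_[p] ℚ_[p])))
        ≃ₗ[ℤ_[p]]
       (Module.Dual ℤ_[p] M ⧸
          LinearMap.range
            ((1 : Module.Dual ℤ_[p] M →ₗ[ℤ_[p]] Module.Dual ℤ_[p] M) -
              LinearMap.dualMap γ.symm.toLinearMap))) := by
  have hcard : ((Nat.card (M ⧸ LinearMap.range ((1 : M →ₗ[ℤ_[p]] M) - γ.toLinearMap)) : ℕ) :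
      ℤ_[p]) ≠ 0 := Nat.cast_ne_zero.2 Nat.card_pos.ne'
  obtain ⟨g, d, hd, hgf, hfg⟩ := exists_comp_eq_smul_of_smul_mem_range
    ((1 : M →ₗ[ℤ_[p]] M) - γ.toLinearMap) hcard fun m ↦ by
      rw [← Submodule.Quotient.mk_eq_zero, Submodule.Quotient.mk_smul, Nat.cast_smul_eq_nsmul]
      exact card_nsmul_eq_zero'
  have hd' : algebraMap ℤ_[p] ℚ_[p] d ≠ 0 :=
    (map_ne_zero_iff _ (FaithfulSMul.algebraMap_injective ℤ_[p] ℚ_[p])).2 hd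
  exact ⟨((Submodule.quotEquivOfEq _ _ ((range_one_sub_dualMap_symm γ).trans
    (ker_dualToCokernelHom hd' hgf hfg).symm)).trans
    ((dualToCokernelHom hd' hgf).quotKerEquivOfSurjective
      (dualToCokernelHom_surjective hd' hgf hfg))).symm⟩
end

section
/- Let p be a prime, G a finite abelian group, σ ∈ G, and m an integer with m ≥ 2. Then the element 1 − m·σ of the group ring ℤ_p[G] (where σ is identified with the corresponding basis element of the group ring) is a non-zero-divisor in ℤ_p[G]. -/
/-- In a commutative ring without additive torsion, `1 - m·u` is a non-zero-divisor whenever `u`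
has finite order and `m ≥ 2`. -/
theorem one_sub_zsmul_mem_nonZeroDivisors_of_isOfFinOrder {A : Type*} [CommRing A]
    [Module.IsTorsionFree ℤ A] {u : A} (hu : IsOfFinOrder u) {m : ℤ} (hm : 2 ≤ m) :
    1 - m • u ∈ nonZeroDivisors A := by
  obtain ⟨n, hn, hun⟩ := isOfFinOrder_iff_pow_eq_one.mp hu
  have hmn : (1 : ℤ) - m ^ n ≠ 0 :=
    (sub_neg.mpr (one_lt_pow₀ (by lia) hn.ne')).ne
  have hpow : (1 : A) - (m • u) ^ n = (1 - m ^ n : ℤ) • (1 : A) := by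
    rw [smul_pow, hun, sub_smul, one_smul]
  have hmem : (1 : A) - (m • u) ^ n ∈ nonZeroDivisors A := by
    rw [hpow, mem_nonZeroDivisors_iff_right]
    intro x hx
    rw [mul_smul_comm, mul_one] at hx
    exact (smul_eq_zero.mp hx).resolve_left hmn
  obtain ⟨y, hy⟩ := one_sub_dvd_one_sub_pow (m • u) n
  rw [hy] at hmem
  exact (mul_mem_nonZeroDivisors.mp hmem).1

/-- For a prime `p`, a finite abelian group `G`, `σ ∈ G` and an integer `m ≥ 2`, the
element `1 - m·σ` of the group ring `ℤ_p[G]` is a non-zero-divisor. -/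
theorem one_sub_int_smul_nonZeroDivisor
    (p : ℕ) [Fact p.Prime] (G : Type*) [CommGroup G] [Finite G]
    (σ : G) (m : ℤ) (hm : 2 ≤ m) :
    (1 : MonoidAlgebra ℤ_[p] G) - m • MonoidAlgebra.of ℤ_[p] G σ ∈
      nonZeroDivisors (MonoidAlgebra ℤ_[p] G) :=
  one_sub_zsmul_mem_nonZeroDivisors_of_isOfFinOrder
    ((MonoidAlgebra.of ℤ_[p] G).isOfFinOrder (isOfFinOrder_of_finite σ)) hm
end

section
/- Let p be a prime, G a finite abelian group, σ ∈ G, and m an integer with m ≥ 2. Then the quotient ring ℤ_p[G]/(1 − m·σ), the quotient of the group ring ℤ_p[G] by the principal ideal generated by 1 − m·σ, is a finite set. -/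
/-- A finitely generated `ℤ_p`-module killed by a nonzero `p`-adic integer is finite. -/
theorem PadicInt.finite_of_isTorsionBy {p : ℕ} [Fact p.Prime] {M : Type*} [AddCommGroup M]
    [Module ℤ_[p] M] [Module.Finite ℤ_[p] M] {a : ℤ_[p]} (ha : a ≠ 0)
    (h : Module.IsTorsionBy ℤ_[p] M a) : Finite M := by
  have : Finite (ℤ_[p] ⧸ Ideal.span {a}) := by
    rw [← IsLocalRing.isOpen_iff_finite_quotient]
    exact IsDedekindDomain.isOpen_of_ne_bot (by simpa using ha)
  have h' : Module.IsTorsionBySet ℤ_[p] M (Ideal.span {a} : Ideal ℤ_[p]) :=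
    (Module.isTorsionBySet_span_singleton_iff a).2 h
  let := h'.module
  have := h'.isScalarTower (S := ℤ_[p])
  have : Module.Finite (ℤ_[p] ⧸ Ideal.span {a}) M :=
    Module.Finite.of_restrictScalars_finite ℤ_[p] _ _
  exact Module.finite_of_finite (ℤ_[p] ⧸ Ideal.span {a})

/-- For a prime `p`, a finite abelian group `G`, `σ ∈ G` and an integer `m ≥ 2`, the
quotient ring `ℤ_p[G]/(1 - m·σ)` is finite. -/
theorem quotient_one_sub_int_smul_finite
    (p : ℕ) [Fact p.Prime] (G : Type*) [CommGroup G] [Finite G]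
    (σ : G) (m : ℤ) (hm : 2 ≤ m) :
    Finite (MonoidAlgebra ℤ_[p] G ⧸
      Ideal.span {(1 : MonoidAlgebra ℤ_[p] G) - m • MonoidAlgebra.of ℤ_[p] G σ}) := by
  have hm' : (1 : ℤ) - m ^ orderOf σ ≠ 0 := by
    have := one_lt_pow₀ (by lia : 1 < m) (orderOf_pos σ).ne'
    lia
  refine PadicInt.finite_of_isTorsionBy (p := p) (a := ((1 - m ^ orderOf σ : ℤ) : ℤ_[p]))
    (by exact_mod_cast hm') ?_
  intro x
  obtain ⟨y, rfl⟩ := Ideal.Quotient.mk_surjective x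
  rw [Int.cast_smul_eq_zsmul, ← map_zsmul (Ideal.Quotient.mk _), Ideal.Quotient.eq_zero_iff_mem,
    Ideal.mem_span_singleton, zsmul_eq_mul y]
  refine Dvd.dvd.mul_right ?_ y
  convert sub_dvd_pow_sub_pow (1 : MonoidAlgebra ℤ_[p] G)
    (m • MonoidAlgebra.of ℤ_[p] G σ) (orderOf σ) using 1
  rw [smul_pow, ← map_pow, pow_orderOf_eq_one, map_one, one_pow, zsmul_one]
  push_cast
  rfl
end

section
/- Let p and ℓ be primes with ℓ ≠ p, and let A be an abelian group such that: (i) A has no p-torsion, i.e., the only a ∈ A with p·a = 0 is a = 0; and (ii) A ⊗_ℤ ℤ_ℓ is a finite set. Then A ⊗_ℤ ℤ_p = 0. -/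
open scoped TensorProduct

/-- If `A` contains an element of infinite order, then `A ⊗ M` is infinite for every infinite
flat abelian group `M`. -/
theorem isOfFinAddOrder_of_finite_tensorProduct {A M : Type*} [AddCommGroup A] [AddCommGroup M]
    [Module.Flat ℤ M] [Infinite M] [Finite (A ⊗[ℤ] M)] (a : A) : IsOfFinAddOrder a := by
  by_contra ha
  have hinj : Function.Injective (LinearMap.toSpanSingleton ℤ A a) := by
    simpa [Function.Injective] using injective_zsmul_iff_not_isOfFinAddOrder.mpr ha
  have hinj' := Module.Flat.rTensor_preserves_injective_linearMap (M := M) _ hinj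
  have hM : Finite M :=
    Finite.of_injective _ (hinj'.comp (TensorProduct.lid ℤ M).symm.injective)
  exact not_finite M

/-- In an additive group without `p`-torsion, `p` does not divide the order of an element of
finite order. -/
theorem not_dvd_addOrderOf {A : Type*} [AddCommGroup A] {p : ℕ} (hp : p.Prime)
    (htors : ∀ a : A, p • a = 0 → a = 0) {a : A} (ha : IsOfFinAddOrder a) :
    ¬ p ∣ addOrderOf a := by
  rintro ⟨m, hm⟩
  have hma : m • a = 0 := htors _ (by rw [← mul_nsmul', ← hm, addOrderOf_nsmul_eq_zero])
  have hpos := ha.addOrderOf_pos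
  have hm0 : 0 < m := Nat.pos_of_ne_zero (by rintro rfl; simp [hm] at hpos)
  have hle := addOrderOf_le_of_nsmul_eq_zero hm0 hma
  nlinarith [hp.two_le]

/-- Let `p ≠ ℓ` be primes and `A` an abelian group with no `p`-torsion such that
`A ⊗_ℤ ℤ_ℓ` is finite. Then `A ⊗_ℤ ℤ_p = 0`. -/
theorem tensor_padicInt_eq_zero
    (p ℓ : ℕ) [Fact p.Prime] [Fact ℓ.Prime] (hpl : ℓ ≠ p)
    {A : Type*} [AddCommGroup A]
    (htors : ∀ a : A, p • a = 0 → a = 0)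
    (hfin : Finite (A ⊗[ℤ] ℤ_[ℓ])) :
    ∀ x : A ⊗[ℤ] ℤ_[p], x = 0 := by
  have : Infinite ℤ_[ℓ] := Infinite.of_injective _ (Nat.cast_injective (R := ℤ_[ℓ]))
  intro x
  induction x with
  | zero => rfl
  | add x y hx hy => rw [hx, hy, add_zero]
  | tmul a z =>
    have ha : IsOfFinAddOrder a := isOfFinAddOrder_of_finite_tensorProduct (M := ℤ_[ℓ]) a
    have hn := not_dvd_addOrderOf (Fact.out : p.Prime) htors ha
    have hunit : IsUnit ((addOrderOf a : ℕ) : ℤ_[p]) := by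
      rw [PadicInt.isUnit_iff, PadicInt.norm_natCast_eq_one_iff]
      exact (Nat.Prime.coprime_iff_not_dvd Fact.out).mpr hn
    obtain ⟨w, hw⟩ := hunit.dvd (a := z)
    rw [hw, ← nsmul_eq_mul, TensorProduct.tmul_smul, TensorProduct.smul_tmul',
      addOrderOf_nsmul_eq_zero, TensorProduct.zero_tmul]
end
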